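/- Let φ : (1,∞) → ℝ be measurable with C_φ := ∫₁^∞ |φ(σ)|/σ dσ < ∞, and let f ∈ L¹(ℝ) with M_P f integrable. Define Kf(x) = ∫₁^∞ φ(σ) f(xσ) dσ. Then ‖Kf‖_{H¹} ≤ C_φ ‖f‖_{H¹}, where ‖g‖_{H¹} = ‖M_P g‖_{L¹}. -/

import Mathlib

open MeasureTheory Set

noncomputable def P (t x : ℝ) : ℝ := (1 / Real.pi) * t / (t ^ 2 + x ^ 2)

noncomputable def conv (g f : ℝ → ℝ) (x : ℝ) : ℝ := ∫ y, g (x - y) * f y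

noncomputable def MP (f : ℝ → ℝ) (x : ℝ) : ℝ :=
  ⨆ t : {t : ℝ // 0 < t}, |conv (P t.1) f x|


lemma P_nonneg {t : ℝ} (ht : 0 < t) (u : ℝ) : 0 ≤ P t u := by
  unfold P; positivity

lemma P_le {t : ℝ} (ht : 0 < t) (u : ℝ) : P t u ≤ 1 / (Real.pi * t) := by
  unfold P
  rw [div_le_div_iff₀ (by positivity) (by positivity)]
  have := Real.pi_pos
  field_simp
  nlinarith [sq_nonneg u]

lemma P_cont {t : ℝ} (ht : 0 < t) : Continuous (P t) := by
  unfold P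
  refine Continuous.div (by fun_prop) (by fun_prop) (fun x => by positivity)

lemma P_scale {t σ : ℝ} (ht : 0 < t) (hσ : 0 < σ) (u : ℝ) :
    P t u = σ * P (t * σ) (u * σ) := by
  unfold P
  have := Real.pi_pos
  have h1 : t ^ 2 + u ^ 2 ≠ 0 := by positivity
  have h2 : (t * σ) ^ 2 + (u * σ) ^ 2 ≠ 0 := by positivity
  field_simp

lemma P_one_integrable : Integrable (P 1) := by
  have : P 1 = fun x => (1 / Real.pi) * (1 + x ^ 2)⁻¹ := by
    ext x; simp [P, div_eq_mul_inv]
  rw [this]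
  exact integrable_inv_one_add_sq.const_mul _

lemma P_lint {t : ℝ} (ht : 0 < t) (z : ℝ) :
    ∫⁻ y, ENNReal.ofReal (P t (z - y)) = ENNReal.ofReal (∫ y, P 1 y) := by
  rw [lintegral_sub_left_eq_self (fun y => ENNReal.ofReal (P t y)) z]
  have hs : ∀ u, P t u = t⁻¹ * P 1 (u * t⁻¹) := fun u => by
    have := P_scale ht (inv_pos.2 ht) u
    rwa [mul_inv_cancel₀ ht.ne'] at this
  have hi : Integrable (P t) := by
    rw [funext hs]
    exact (P_one_integrable.comp_mul_right' (inv_ne_zero ht.ne')).const_mul _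
  rw [← ofReal_integral_eq_lintegral_ofReal hi (Filter.Eventually.of_forall (P_nonneg ht))]
  congr 1
  rw [funext hs, integral_const_mul, Measure.integral_comp_mul_right]
  rw [inv_inv, abs_of_pos ht, smul_eq_mul, ← mul_assoc, inv_mul_cancel₀ ht.ne', one_mul]

/-- A finite measure has a finite maximal function almost everywhere. -/
lemma ball_bound (ν : Measure ℝ) [IsFiniteMeasure ν] :
    ∀ᵐ z, ∃ C : NNReal, ∀ r : ℝ, 0 < r → ν (Metric.closedBall z r) ≤
      C * volume (Metric.closedBall z r) := by
  filter_upwards [Besicovitch.ae_tendsto_rnDeriv ν (volume : Measure ℝ),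
    Measure.rnDeriv_lt_top ν (volume : Measure ℝ)] with z hz hfin
  obtain ⟨c, hc1, hc2⟩ := ENNReal.lt_iff_exists_nnreal_btwn.1 hfin
  have hev := hz.eventually_lt_const hc1
  rw [Filter.eventually_iff, mem_nhdsGT_iff_exists_Ioo_subset] at hev
  obtain ⟨r0, hr0, hsub⟩ := hev
  have hr0 : 0 < r0 := hr0
  set D : NNReal := (ν univ).toNNReal / (2 * r0).toNNReal with hD
  refine ⟨c + D, fun r hr => ?_⟩
  by_cases h : r < r0
  · have := hsub ⟨hr, h⟩
    simp only [mem_ofPred_eq] at this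
    have hv : volume (Metric.closedBall z r) ≠ 0 := by
      rw [Real.volume_closedBall]; simpa using hr
    have hv' : volume (Metric.closedBall z r) ≠ ⊤ := by
      rw [Real.volume_closedBall]; exact ENNReal.ofReal_ne_top
    have := (ENNReal.div_le_iff hv hv').1 this.le
    refine this.trans ?_
    gcongr
    push_cast
    exact le_self_add
  · push Not at h
    have h2 : (0:ℝ) < 2 * r0 := by positivity
    calc ν (Metric.closedBall z r) ≤ ν univ := measure_mono (subset_univ _)
      _ = D * ENNReal.ofReal (2 * r0) := by
        rw [hD, ENNReal.ofReal, ← ENNReal.coe_mul, div_mul_cancel₀ _ (by simpa using hr0),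
          ENNReal.coe_toNNReal (measure_ne_top _ _)]
      _ ≤ _ := by
        rw [Real.volume_closedBall]
        gcongr
        push_cast
        exact le_add_self

lemma level_set {t : ℝ} (ht : 0 < t) (z s : ℝ) (hs : 0 < s) :
    {y | s < P t (z - y)} = ∅ ∨ ∃ r, 0 < r ∧ {y | s < P t (z - y)} = Metric.ball z r := by
  have hpi := Real.pi_pos
  have key : ∀ y, s < P t (z - y) ↔ (z - y) ^ 2 < t / (Real.pi * s) - t ^ 2 := fun y => by
    unfold P
    rw [lt_div_iff₀ (by positivity), lt_sub_iff_add_lt, lt_div_iff₀ (by positivity)]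
    have : 1 / Real.pi * t = t / Real.pi := by ring
    rw [this, lt_div_iff₀ hpi]
    constructor <;> intro h <;> nlinarith
  by_cases h : 0 < t / (Real.pi * s) - t ^ 2
  · right
    refine ⟨Real.sqrt (t / (Real.pi * s) - t ^ 2), Real.sqrt_pos.2 h, ?_⟩
    ext y
    rw [mem_ofPred_eq, key, Metric.mem_ball, dist_comm, Real.dist_eq, Real.lt_sqrt (abs_nonneg _),
      sq_abs]
  · left
    ext y
    simp only [mem_ofPred_eq, key, mem_empty_iff_false, iff_false]
    nlinarith [sq_nonneg (z - y)]

lemma bdd_ae (f : ℝ → ℝ) (hf : Integrable f) :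
    ∀ᵐ z, ∃ C : ℝ, ∀ t : ℝ, 0 < t → |conv (P t) f z| ≤ C := by
  set ν : Measure ℝ := volume.withDensity (fun y => ‖f y‖ₑ) with hν
  have : IsFiniteMeasure ν := isFiniteMeasure_withDensity hf.2.ne
  filter_upwards [ball_bound ν] with z ⟨C, hC⟩
  refine ⟨(C * ENNReal.ofReal (∫ y, P 1 y)).toReal, fun t ht => ?_⟩
  have hmeas : Measurable fun y => P t (z - y) := ((P_cont ht).comp (by fun_prop)).measurable
  have h1 : ∫⁻ y, ENNReal.ofReal (P t (z - y)) ∂ν ≤ C * ENNReal.ofReal (∫ y, P 1 y) := by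
    rw [← P_lint ht z]
    rw [lintegral_eq_lintegral_meas_lt ν (Filter.Eventually.of_forall fun y => P_nonneg ht _)
      hmeas.aemeasurable, lintegral_eq_lintegral_meas_lt volume
      (Filter.Eventually.of_forall fun y => P_nonneg ht _) hmeas.aemeasurable,
      ← lintegral_const_mul' _ _ ENNReal.coe_ne_top]
    refine setLIntegral_mono' measurableSet_Ioi fun s hs => ?_
    rcases level_set ht z s hs with h | ⟨r, hr, h⟩
    · rw [h]; simp
    · rw [h, Real.volume_ball, ← Real.volume_closedBall]
      exact (measure_mono Metric.ball_subset_closedBall).trans (hC r hr)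
  have h2 : ‖conv (P t) f z‖ₑ ≤ ∫⁻ y, ENNReal.ofReal (P t (z - y)) ∂ν := by
    rw [hν, lintegral_withDensity_eq_lintegral_mul₀ hf.1.enorm hmeas.ennreal_ofReal.aemeasurable]
    refine (enorm_integral_le_lintegral_enorm _).trans (le_of_eq ?_)
    refine lintegral_congr fun y => ?_
    rw [enorm_mul, Real.enorm_of_nonneg (P_nonneg ht _), Pi.mul_apply, mul_comm]
  have h3 := ENNReal.toReal_mono (by finiteness) (h2.trans h1)
  simpa using h3

lemma prod_int (φ : ℝ → ℝ) (hφ : Measurable φ)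
    (hK : IntegrableOn (fun σ => |φ σ| / σ) (Ioi (1:ℝ)))
    (g : ℝ → ℝ) (hgm : Measurable g) (hg : Integrable g) :
    Integrable (fun p : ℝ × ℝ => φ p.2 * g (p.1 * p.2))
      ((volume : Measure ℝ).prod (volume.restrict (Ioi (1:ℝ)))) := by
  have hm : Measurable (fun p : ℝ × ℝ => φ p.2 * g (p.1 * p.2)) := by fun_prop
  rw [integrable_prod_iff' hm.aestronglyMeasurable]
  constructor
  · filter_upwards [ae_restrict_mem measurableSet_Ioi] with σ hσ
    exact (hg.comp_mul_right' (zero_lt_one.trans hσ).ne').const_mul _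
  · refine (hK.mul_const (∫ y, ‖g y‖)).congr ?_
    filter_upwards [ae_restrict_mem measurableSet_Ioi] with σ hσ
    have hσ : 0 < σ := zero_lt_one.trans hσ
    simp only [norm_mul]
    rw [integral_const_mul, Measure.integral_comp_mul_right (fun y => ‖g y‖), abs_of_pos (inv_pos.2 hσ)]
    simp only [Real.norm_eq_abs, smul_eq_mul]
    ring

lemma prod_val (φ : ℝ → ℝ) (hφ : Measurable φ)
    (hK : IntegrableOn (fun σ => |φ σ| / σ) (Ioi (1:ℝ)))
    (g : ℝ → ℝ) (hgm : Measurable g) (hg : Integrable g) :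
    ∫ x, ∫ σ in Ioi (1:ℝ), |φ σ| * g (x * σ) = (∫ σ in Ioi (1:ℝ), |φ σ| / σ) * ∫ y, g y := by
  have h := prod_int (fun σ => |φ σ|) (by fun_prop) (by simpa using hK) g hgm hg
  rw [integral_integral_swap h, ← integral_mul_const]
  refine setIntegral_congr_fun measurableSet_Ioi fun σ hσ => ?_
  have hσ : 0 < σ := zero_lt_one.trans hσ
  rw [integral_const_mul, Measure.integral_comp_mul_right, abs_of_pos (inv_pos.2 hσ), smul_eq_mul]
  ring

lemma conv_scale (f : ℝ → ℝ) {t σ : ℝ} (ht : 0 < t) (hσ : 0 < σ) (x : ℝ) :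
    ∫ y, P t (x - y) * f (y * σ) = conv (P (t * σ)) f (x * σ) := by
  unfold conv
  have := Measure.integral_comp_mul_right (fun y => σ * (P (t * σ) (x * σ - y) * f y)) σ
  rw [integral_const_mul σ (fun y => P (t * σ) (x * σ - y) * f y), abs_of_pos (inv_pos.2 hσ),
    smul_eq_mul, ← mul_assoc, inv_mul_cancel₀ hσ.ne', one_mul] at this
  rw [← this]
  congr 1; ext y
  rw [P_scale ht hσ, sub_mul, mul_assoc]

lemma conv_congr (g : ℝ → ℝ) {f f' : ℝ → ℝ} (h : f =ᵐ[volume] f') : conv g f = conv g f' := by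
  ext x
  refine integral_congr_ae ?_
  filter_upwards [h] with y hy
  rw [hy]

lemma MP_congr {f f' : ℝ → ℝ} (h : f =ᵐ[volume] f') : MP f = MP f' := by
  ext x; simp only [MP, conv_congr _ h]

lemma ae_scale {p : ℝ → Prop} (h : ∀ᵐ z, p z) {x : ℝ} (hx : x ≠ 0) : ∀ᵐ σ, p (x * σ) := by
  have hq : Measure.QuasiMeasurePreserving (fun σ : ℝ => x * σ) volume volume := by
    refine ⟨by fun_prop, ?_⟩
    rw [Real.map_volume_mul_left hx]
    exact Measure.smul_absolutelyContinuous
  exact hq.ae h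

lemma main_meas (φ : ℝ → ℝ) (hφ : Measurable φ)
    (hK : IntegrableOn (fun σ => |φ σ| / σ) (Ioi (1:ℝ)))
    (f : ℝ → ℝ) (hfm : Measurable f) (hf : Integrable f) (hMP : Integrable (MP f)) :
    (∫ y, MP (fun x => ∫ σ in Ioi (1:ℝ), φ σ * f (x * σ)) y) ≤
      (∫ σ in Ioi (1:ℝ), |φ σ| / σ) * ∫ y, MP f y := by
  set G : ℝ → ℝ := hMP.1.mk (MP f) with hG
  have hGeq : MP f =ᵐ[volume] G := hMP.1.ae_eq_mk
  have hGm : Measurable G := hMP.1.stronglyMeasurable_mk.measurable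
  have hGi : Integrable G := hMP.congr hGeq
  rw [integral_congr_ae hGeq, ← prod_val φ hφ hK G hGm hGi]
  have hprodG := prod_int (fun σ => |φ σ|) (by fun_prop) (by simpa using hK) G hGm hGi
  have hprodf := prod_int φ hφ hK f hfm hf
  have hdom : ∀ᵐ z, ∀ t : ℝ, 0 < t → |conv (P t) f z| ≤ G z := by
    filter_upwards [bdd_ae f hf, hGeq] with z ⟨C, hC⟩ hz t ht
    rw [← hz]
    exact le_ciSup (f := fun t : {t : ℝ // 0 < t} => |conv (P t.1) f z|)
      ⟨C, by rintro _ ⟨s, rfl⟩; exact hC s.1 s.2⟩ ⟨t, ht⟩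
  refine integral_mono_of_nonneg
    (Filter.Eventually.of_forall fun x => Real.iSup_nonneg fun _ => abs_nonneg _)
    hprodG.integral_prod_left ?_
  have hne : ∀ᵐ x : ℝ, x ≠ 0 := by simp [ae_iff]
  filter_upwards [hne, hprodG.prod_right_ae] with x hx hxi
  have : Nonempty {t : ℝ // 0 < t} := ⟨⟨1, one_pos⟩⟩
  refine ciSup_le fun ⟨t, ht⟩ => ?_
  have hswap : conv (P t) (fun x => ∫ σ in Ioi (1:ℝ), φ σ * f (x * σ)) x =
      ∫ σ in Ioi (1:ℝ), φ σ * conv (P (t * σ)) f (x * σ) := by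
    unfold conv
    simp_rw [← integral_const_mul]
    rw [integral_integral_swap]
    · refine setIntegral_congr_fun measurableSet_Ioi fun σ hσ => ?_
      have hσ : 0 < σ := zero_lt_one.trans hσ
      have := conv_scale f ht hσ x
      unfold conv at this
      rw [integral_const_mul (φ σ) (fun a => P (t * σ) (x * σ - a) * f a), ← this, ← integral_const_mul]
      congr 1; ext y; ring
    · refine hprodf.bdd_mul (c := 1 / (Real.pi * t)) (f := fun p : ℝ × ℝ => P t (x - p.1)) ?_ ?_
      · exact ((P_cont ht).comp (by fun_prop)).aestronglyMeasurable
      · refine Filter.Eventually.of_forall fun p => ?_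
        rw [Real.norm_of_nonneg (P_nonneg ht _)]
        exact P_le ht _
  simp only
  rw [hswap, ← Real.norm_eq_abs]
  refine norm_integral_le_of_norm_le hxi ?_
  filter_upwards [ae_restrict_of_ae (ae_scale hdom hx), ae_restrict_mem measurableSet_Ioi]
    with σ h hσ
  rw [norm_mul, Real.norm_eq_abs, Real.norm_eq_abs]
  exact mul_le_mul_of_nonneg_left (h _ (mul_pos ht (zero_lt_one.trans hσ))) (abs_nonneg _)

theorem stmt17 (φ : ℝ → ℝ) (hφ : Measurable φ)
    (hK : IntegrableOn (fun σ => |φ σ| / σ) (Ioi (1:ℝ)))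
    (f : ℝ → ℝ) (hf : Integrable f) (hMP : Integrable (MP f)) :
    (∫ y, MP (fun x => ∫ σ in Ioi (1:ℝ), φ σ * f (x * σ)) y) ≤
      (∫ σ in Ioi (1:ℝ), |φ σ| / σ) * ∫ y, MP f y := by
  have hfe : f =ᵐ[volume] hf.1.mk f := hf.1.ae_eq_mk
  have hne : ∀ᵐ x : ℝ, x ≠ 0 := by simp [ae_iff]
  have hKe : (fun x => ∫ σ in Ioi (1:ℝ), φ σ * f (x * σ)) =ᵐ[volume]
      (fun x => ∫ σ in Ioi (1:ℝ), φ σ * hf.1.mk f (x * σ)) := by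
    filter_upwards [hne] with x hx
    refine integral_congr_ae (ae_restrict_of_ae ?_)
    filter_upwards [ae_scale hfe hx] with σ h
    rw [h]
  rw [MP_congr hKe, MP_congr hfe]
  rw [MP_congr hfe] at hMP
  exact main_meas φ hφ hK _ hf.1.stronglyMeasurable_mk.measurable (hf.congr hfe) hMP
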